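/- For each j with 0 ≤ j ≤ N₂, the number C_{2,j} of codewords of Hamming weight j in the ternary code C(O(3,q)) equals the sum, over all pairs of functions ν, μ : F_q → ℕ satisfying ∑_{β∈F_q} ν(β) + ∑_{β∈F_q} μ(β) = j and ∑_{β∈F_q} ν(β)·β = ∑_{β∈F_q} μ(β)·β in F_q, of the product ∏_{β∈F_q} T(n₂(β); ν(β), μ(β)), where n₂(β) = 2q² - 2q + q·δ(1,q;β-1) + q·δ(1,q;β+1). -/

import Mathlib

open Finset Matrix

/-- The matrix J defining the orthogonal group O(3,q). -/
def matJ (F : Type) [Field F] : Matrix (Fin 3) (Fin 3) F := !![0,1,0; 1,0,0; 0,0,1]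

/-- `δ(1,q;β) = |{x ∈ F_q : x² - βx + 1 = 0}|`. -/
def delta1 (F : Type) [Field F] [Fintype F] [DecidableEq F] (β : F) : ℕ :=
  (Finset.univ.filter (fun x : F => x ^ 2 - β * x + 1 = 0)).card

/-- The trinomial coefficient `c!/(a!·b!·(c-a-b)!)` for `a + b ≤ c`, and 0 otherwise. -/
def trinom (c a b : ℕ) : ℕ :=
  if a + b ≤ c then c.factorial / (a.factorial * b.factorial * (c - a - b).factorial)
  else 0

/-- The number of codewords of Hamming weight j in the ternary code C(O(3,q)),
the code of vectors u ∈ F_3^{O(3,q)} with ∑_g u_g·Tr(g) = 0 in F_q. -/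
def weightCountO (F : Type) [Field F] [Fintype F] [DecidableEq F]
    [Algebra (ZMod 3) F] (j : ℕ) : ℕ :=
  (Finset.univ.filter
    (fun u : {w : Matrix (Fin 3) (Fin 3) F //
                w.det ≠ 0 ∧ wᵀ * matJ F * w = matJ F} → ZMod 3 =>
      (∑ g, algebraMap (ZMod 3) F (u g) * g.val.trace) = 0 ∧
        (Finset.univ.filter (fun g => u g ≠ 0)).card = j)).card

section Orthogonal

variable {F : Type} [Field F]

/-- The matrices of the orthogonal group whose first column is a multiple of the first basis
vector. -/
def borelMatrix (e a t : F) : Matrix (Fin 3) (Fin 3) F :=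
  !![a, a * t ^ 2, -(e * a * t); 0, a⁻¹, 0; 0, t, e]

/-- The matrices of the orthogonal group in the big Bruhat cell. -/
def bigCellMatrix (e d s t : F) : Matrix (Fin 3) (Fin 3) F :=
  !![d * s ^ 2, d⁻¹ * (1 - d * s * t) ^ 2, e * s * (1 - d * s * t);
     d, d * t ^ 2, -(e * d * t);
     d * s, -(t * (1 - d * s * t)), e * (-1 - d * s * t)]

lemma transpose_mul_matJ_mul_eq_iff (w : Matrix (Fin 3) (Fin 3) F) :
    wᵀ * matJ F * w = matJ F ↔
      2 * w 0 0 * w 1 0 + w 2 0 ^ 2 = 0 ∧ 2 * w 0 1 * w 1 1 + w 2 1 ^ 2 = 0 ∧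
      2 * w 0 2 * w 1 2 + w 2 2 ^ 2 = 1 ∧
      w 0 0 * w 1 1 + w 1 0 * w 0 1 + w 2 0 * w 2 1 = 1 ∧
      w 0 0 * w 1 2 + w 1 0 * w 0 2 + w 2 0 * w 2 2 = 0 ∧
      w 0 1 * w 1 2 + w 1 1 * w 0 2 + w 2 1 * w 2 2 = 0 := by
  constructor
  · intro h
    have H : ∀ i j, (wᵀ * matJ F * w) i j = matJ F i j := fun i j => by rw [h]
    have h00 := H 0 0
    have h11 := H 1 1
    have h22 := H 2 2
    have h01 := H 0 1
    have h02 := H 0 2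
    have h12 := H 1 2
    simp [matJ, Matrix.mul_apply, Fin.sum_univ_three] at h00 h11 h22 h01 h02 h12
    refine ⟨?_, ?_, ?_, ?_, ?_, ?_⟩
    · linear_combination h00
    · linear_combination h11
    · linear_combination h22
    · linear_combination h01
    · linear_combination h02
    · linear_combination h12
  · rintro ⟨h00, h11, h22, h01, h02, h12⟩
    ext i j
    fin_cases i <;> fin_cases j <;> simp [matJ, Matrix.mul_apply, Fin.sum_univ_three]
    · linear_combination h00
    · linear_combination h01
    · linear_combination h02
    · linear_combination h01
    · linear_combination h11
    · linear_combination h12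
    · linear_combination h02
    · linear_combination h12
    · linear_combination h22

lemma det_matJ : (matJ F).det = -1 := by
  simp [matJ, Matrix.det_fin_three]

lemma matJ_mul_self : matJ F * matJ F = 1 := by
  ext i j
  fin_cases i <;> fin_cases j <;> simp [matJ, Matrix.mul_apply, Fin.sum_univ_three]

lemma det_sq_of_orthogonal {w : Matrix (Fin 3) (Fin 3) F} (h : wᵀ * matJ F * w = matJ F) :
    w.det ^ 2 = 1 := by
  have := congrArg Matrix.det h
  rw [Matrix.det_mul, Matrix.det_mul, Matrix.det_transpose, det_matJ] at this
  linear_combination -this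

lemma adjugate_of_orthogonal {w : Matrix (Fin 3) (Fin 3) F} (h : wᵀ * matJ F * w = matJ F) :
    w.adjugate = w.det • (matJ F * wᵀ * matJ F) := by
  have h1 : (matJ F * wᵀ * matJ F) * w = 1 := by
    rw [Matrix.mul_assoc, Matrix.mul_assoc, ← Matrix.mul_assoc wᵀ, h, matJ_mul_self]
  have h2 := mul_eq_one_comm.mp h1
  calc w.adjugate = w.adjugate * (w * (matJ F * wᵀ * matJ F)) := by rw [h2, Matrix.mul_one]
    _ = _ := by rw [← Matrix.mul_assoc, Matrix.adjugate_mul, Matrix.smul_mul, Matrix.one_mul]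

lemma last_column_of_orthogonal {w : Matrix (Fin 3) (Fin 3) F} (h : wᵀ * matJ F * w = matJ F) :
    w 0 2 = w.det * (w 0 1 * w 2 0 - w 0 0 * w 2 1) ∧
    w 1 2 = w.det * (w 1 0 * w 2 1 - w 1 1 * w 2 0) ∧
    w 2 2 = w.det * (w 0 0 * w 1 1 - w 0 1 * w 1 0) := by
  have hd := det_sq_of_orthogonal h
  have H : ∀ i j, w.adjugate i j = (w.det • (matJ F * wᵀ * matJ F)) i j :=
    fun i j => by rw [adjugate_of_orthogonal h]
  have h0 := H 2 0
  have h1 := H 2 1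
  have h2 := H 2 2
  rw [Matrix.adjugate_fin_three] at h0 h1 h2
  generalize w.det = e at *
  simp [matJ, Matrix.mul_apply, Matrix.vecMul, dotProduct, Fin.sum_univ_three] at h0 h1 h2
  refine ⟨?_, ?_, ?_⟩
  · linear_combination (-w 0 2) * hd - e * h1
  · linear_combination (-w 1 2) * hd - e * h0
  · linear_combination (-w 2 2) * hd - e * h2

lemma trace_borelMatrix (e a t : F) : (borelMatrix e a t).trace = a + a⁻¹ + e := by
  simp [borelMatrix, Matrix.trace_fin_three]

variable [CharP F 3]

lemma three_eq_zero_of_charP : (3 : F) = 0 := by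
  exact_mod_cast CharP.cast_eq_zero F 3

lemma borelMatrix_orthogonal {e a : F} (t : F) (he : e ^ 2 = 1) (ha : a ≠ 0) :
    (borelMatrix e a t)ᵀ * matJ F * borelMatrix e a t = matJ F := by
  have h3 := three_eq_zero_of_charP (F := F)
  rw [transpose_mul_matJ_mul_eq_iff]
  simp [borelMatrix, ha, he]
  refine ⟨?_, ?_⟩
  · field_simp
    linear_combination t ^ 2 * h3
  · field_simp
    ring

lemma bigCellMatrix_orthogonal {e d : F} (s t : F) (he : e ^ 2 = 1) (hd : d ≠ 0) :
    (bigCellMatrix e d s t)ᵀ * matJ F * bigCellMatrix e d s t = matJ F := by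
  have h3 := three_eq_zero_of_charP (F := F)
  rw [transpose_mul_matJ_mul_eq_iff]
  simp [bigCellMatrix]
  refine ⟨?_, ?_, ?_, ?_, ?_, ?_⟩
  · linear_combination d ^ 2 * s ^ 2 * h3
  · field_simp
    linear_combination t ^ 2 * (1 - d * s * t) ^ 2 * h3
  · linear_combination (1 + 3 * d ^ 2 * s ^ 2 * t ^ 2) * he + d ^ 2 * s ^ 2 * t ^ 2 * h3
  · field_simp
    linear_combination (d ^ 2 * s ^ 2 * t ^ 2 - d * s * t) * h3
  · linear_combination (-e * d ^ 2 * s ^ 2 * t) * h3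
  · field_simp
    linear_combination e * (d * s * t ^ 2 - d ^ 2 * s ^ 2 * t ^ 3) * h3

lemma eq_borelMatrix_of_orthogonal {w : Matrix (Fin 3) (Fin 3) F}
    (h : wᵀ * matJ F * w = matJ F) (h0 : w 1 0 = 0) :
    w 0 0 ≠ 0 ∧ w 2 2 ^ 2 = 1 ∧ w = borelMatrix (w 2 2) (w 0 0) (w 2 1) := by
  have h3 := three_eq_zero_of_charP (F := F)
  obtain ⟨h00, h11, h22, h01, h02, h12⟩ := (transpose_mul_matJ_mul_eq_iff w).mp h
  have h20 : w 2 0 = 0 := by simpa [h0] using h00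
  have hab : w 0 0 * w 1 1 = 1 := by simpa [h0, h20] using h01
  have ha : w 0 0 ≠ 0 := left_ne_zero_of_mul_eq_one hab
  have hw12 : w 1 2 = 0 := by simpa [h0, h20, ha] using h02
  have hw11 : w 1 1 = (w 0 0)⁻¹ := eq_inv_of_mul_eq_one_right hab
  refine ⟨ha, by simpa [hw12] using h22, ?_⟩
  have hw01 : w 0 1 = w 0 0 * w 2 1 ^ 2 := by
    linear_combination (w 0 1 * w 0 0 * w 1 1) * h3 - w 0 0 * h11 - w 0 1 * hab
  have hw02 : w 0 2 = -(w 2 2 * w 0 0 * w 2 1) := by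
    rw [hw12] at h12
    linear_combination w 0 0 * h12 - w 0 2 * hab
  ext i j
  fin_cases i <;> fin_cases j <;> simp [borelMatrix, *]

lemma eq_bigCellMatrix_of_orthogonal {w : Matrix (Fin 3) (Fin 3) F}
    (h : wᵀ * matJ F * w = matJ F) (h0 : w 1 0 ≠ 0) :
    w = bigCellMatrix w.det (w 1 0) (w 2 0 / w 1 0)
      (w 2 0 / w 1 0 * w 1 1 - w 2 1) := by
  have h3 := three_eq_zero_of_charP (F := F)
  obtain ⟨h00, h11, h22, h01, h02, h12⟩ := (transpose_mul_matJ_mul_eq_iff w).mp h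
  obtain ⟨c0, c1, c2⟩ := last_column_of_orthogonal h
  generalize w.det = e at *
  obtain ⟨s, hs⟩ : ∃ s, w 2 0 = w 1 0 * s := ⟨w 2 0 / w 1 0, by field_simp⟩
  obtain ⟨t, ht⟩ : ∃ t, w 2 1 = s * w 1 1 - t := ⟨s * w 1 1 - w 2 1, by ring⟩
  have hsd : w 2 0 / w 1 0 = s := by rw [hs]; field_simp
  have htd : s * w 1 1 - w 2 1 = t := by rw [ht]; ring
  rw [hsd, htd]
  have e00 : w 0 0 = w 1 0 * s ^ 2 := by
    apply mul_left_cancel₀ h0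
    rw [hs] at h00
    linear_combination w 0 0 * w 1 0 * h3 - h00
  have e01 : w 0 1 = (w 1 0)⁻¹ * (1 - w 1 0 * s ^ 2 * w 1 1 - w 1 0 * s * w 2 1) := by
    field_simp
    rw [hs, e00] at h01
    linear_combination h01
  have e11 : w 1 1 = w 1 0 * t ^ 2 := by
    rw [e01, ht] at h11
    field_simp at h11
    linear_combination (w 1 1 - w 1 0 * s ^ 2 * w 1 1 ^ 2) * h3 - h11
  rw [hs, e01, e00] at c0
  rw [hs] at c1
  rw [e01, e00] at c2
  rw [e11] at ht c1 c2
  rw [ht] at c0 c1 c2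
  rw [ht] at e01
  rw [e11] at e01 c0
  generalize hd : w 1 0 = d at *
  ext i j
  fin_cases i <;> fin_cases j <;> simp [bigCellMatrix]
  · exact e00
  · rw [e01]
    field_simp
    linear_combination (d * s * t - d ^ 2 * s ^ 2 * t ^ 2) * h3
  · rw [c0]
    field_simp
    linear_combination e * (d * s ^ 2 * t - d ^ 2 * s ^ 3 * t ^ 2) * h3
  · exact hd
  · exact e11
  · rw [c1]; ring
  · exact hs
  · rw [ht]; ring
  · rw [c2]
    field_simp
    linear_combination e * d ^ 2 * s ^ 2 * t ^ 2 * h3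

lemma trace_bigCellMatrix {e : F} (d s t : F) (he : e ^ 2 = 1) :
    (bigCellMatrix e d s t).trace = d * (s + e * t) ^ 2 - e := by
  have h3 := three_eq_zero_of_charP (F := F)
  simp [bigCellMatrix, Matrix.trace_fin_three]
  linear_combination (-d * t ^ 2) * he - d * e * s * t * h3

end Orthogonal

section TraceCount

variable {F : Type} [Field F]

lemma borelMatrix_injective {e e' a a' t t' : F} (h : borelMatrix e a t = borelMatrix e' a' t') :
    e = e' ∧ a = a' ∧ t = t' := by
  have H : ∀ i j, borelMatrix e a t i j = borelMatrix e' a' t' i j := fun i j => by rw [h]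
  have h0 := H 2 2
  have h1 := H 0 0
  have h2 := H 2 1
  simp [borelMatrix] at h0 h1 h2
  exact ⟨h0, h1, h2⟩

lemma bigCellMatrix_injective [CharP F 3] {e e' d d' s s' t t' : F} (hd : d ≠ 0)
    (h : bigCellMatrix e d s t = bigCellMatrix e' d' s' t') :
    e = e' ∧ d = d' ∧ s = s' ∧ t = t' := by
  have H : ∀ i j, bigCellMatrix e d s t i j = bigCellMatrix e' d' s' t' i j :=
    fun i j => by rw [h]
  have h0 := H 1 0
  have h1 := H 2 0
  have h2 := H 2 1
  have h3 := H 1 1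
  have h4 := H 2 2
  have h5 := H 1 2
  simp [bigCellMatrix] at h0 h1 h2 h3 h4 h5
  subst h0
  obtain rfl : s = s' := mul_left_cancel₀ hd h1
  obtain rfl : t = t' := by linear_combination s * h3 + h2
  exact ⟨by linear_combination s * -h5 - h4, rfl, rfl, rfl⟩

variable [Fintype F] [DecidableEq F]

lemma card_mul_sq_eq (c : F) :
    #{p : F × F | p.1 ≠ 0 ∧ p.1 * p.2 ^ 2 = c} = Fintype.card F - 1 := by
  have hcard : #{x : F | x ≠ 0} = Fintype.card F - 1 := by
    rw [Finset.filter_ne', Finset.card_erase_of_mem (Finset.mem_univ _), Finset.card_univ]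
  rw [← hcard]
  by_cases hc : c = 0
  · refine Finset.card_nbij' (fun p => p.1) (fun x => (x, 0)) ?_ ?_ ?_ ?_
    · rintro ⟨d, v⟩ h
      simp_all
    · intro x h
      simp_all
    · rintro ⟨d, v⟩ h
      simp [hc] at h
      simp [h.2.resolve_left h.1]
    · intro x h
      simp_all
  · refine Finset.card_nbij' (fun p => p.2) (fun x => (c / x ^ 2, x)) ?_ ?_ ?_ ?_
    · rintro ⟨d, v⟩ h
      simp at h ⊢
      rintro rfl
      apply hc
      simp [← h.2]
    · intro x h
      simp at h
      simp [h, hc]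
    · rintro ⟨d, v⟩ h
      simp at h
      have hv : v ≠ 0 := by
        rintro rfl
        apply hc
        simp [← h.2]
      simp [← h.2, hv]
    · intro x h
      rfl

lemma card_bigCell_parameters (e β : F) :
    #{p : F × F × F | p.1 ≠ 0 ∧ p.1 * (p.2.1 + e * p.2.2) ^ 2 - e = β} =
      (Fintype.card F - 1) * Fintype.card F := by
  rw [← card_mul_sq_eq (β + e), ← Finset.card_univ (α := F), ← Finset.card_product]
  refine Finset.card_nbij' (fun p => ((p.1, p.2.1 + e * p.2.2), p.2.2))
    (fun p => (p.1.1, p.1.2 - e * p.2, p.2)) ?_ ?_ ?_ ?_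
  · rintro ⟨d, s, t⟩ h
    simp at h ⊢
    exact ⟨h.1, by linear_combination h.2⟩
  · rintro ⟨⟨d, v⟩, t⟩ h
    simp at h ⊢
    exact ⟨h.1, by linear_combination h.2⟩
  · rintro ⟨d, s, t⟩ h
    simp
  · rintro ⟨⟨d, v⟩, t⟩ h
    simp

lemma card_borel_parameters (e β : F) :
    #{p : F × F | p.1 ≠ 0 ∧ p.1 + p.1⁻¹ + e = β} = delta1 F (β - e) * Fintype.card F := by
  rw [delta1, ← Finset.card_univ (α := F), ← Finset.card_product]
  congr 1
  ext ⟨a, t⟩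
  simp
  constructor
  · rintro ⟨ha, h⟩
    rw [← h]
    field_simp
    ring
  · intro h
    have ha : a ≠ 0 := by
      rintro rfl
      simp at h
    refine ⟨ha, ?_⟩
    field_simp
    linear_combination h

lemma card_orthogonal_trace_eq [CharP F 3] (β : F) :
    #{g : {w : Matrix (Fin 3) (Fin 3) F // w.det ≠ 0 ∧ wᵀ * matJ F * w = matJ F} |
        g.val.trace = β} =
      2 * Fintype.card F * Fintype.card F - 2 * Fintype.card F +
        Fintype.card F * delta1 F (β - 1) + Fintype.card F * delta1 F (β + 1) := by
  have h3 := three_eq_zero_of_charP (F := F)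
  have h11 : (1 : F) ≠ -1 := by
    intro h
    exact one_ne_zero (α := F) (by linear_combination h3 - h)
  have hsign : ∀ e : F, e ∈ ({1, -1} : Finset F) ↔ e ^ 2 = 1 := by simp
  let A : Finset (Σ _ : F, F × F) := ({1, -1} : Finset F).sigma fun e =>
    {p : F × F | p.1 ≠ 0 ∧ p.1 + p.1⁻¹ + e = β}
  let B : Finset (Σ _ : F, F × F × F) := ({1, -1} : Finset F).sigma fun e =>
    {p : F × F × F | p.1 ≠ 0 ∧ p.1 * (p.2.1 + e * p.2.2) ^ 2 - e = β}
  have hA : A.card = Fintype.card F * delta1 F (β - 1) + Fintype.card F * delta1 F (β + 1) := by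
    rw [Finset.card_sigma, Finset.sum_pair h11, card_borel_parameters, card_borel_parameters,
      sub_neg_eq_add, mul_comm, mul_comm (delta1 F (β + 1))]
  have hB : B.card = 2 * Fintype.card F * Fintype.card F - 2 * Fintype.card F := by
    rw [Finset.card_sigma, Finset.sum_pair h11, card_bigCell_parameters, card_bigCell_parameters,
      Nat.sub_mul, mul_assoc 2]
    omega
  have hdet : ∀ w : Matrix (Fin 3) (Fin 3) F, wᵀ * matJ F * w = matJ F → w.det ≠ 0 := by
    intro w hw h
    simpa [h] using det_sq_of_orthogonal hw
  let f : (Σ _ : F, F × F) → Matrix (Fin 3) (Fin 3) F := fun p =>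
    borelMatrix p.1 p.2.1 p.2.2
  let g : (Σ _ : F, F × F × F) → Matrix (Fin 3) (Fin 3) F := fun p =>
    bigCellMatrix p.1 p.2.1 p.2.2.1 p.2.2.2
  have hf : Set.InjOn f A := by
    rintro ⟨e, a, t⟩ - ⟨e', a', t'⟩ - h
    obtain ⟨rfl, rfl, rfl⟩ := borelMatrix_injective h
    rfl
  have hg : Set.InjOn g B := by
    rintro ⟨e, d, s, t⟩ hp ⟨e', d', s', t'⟩ - h
    have hd : d ≠ 0 := (Finset.mem_filter.mp (Finset.mem_sigma.mp hp).2).2.1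
    obtain ⟨rfl, rfl, rfl, rfl⟩ := bigCellMatrix_injective hd h
    rfl
  have hdisj : Disjoint (B.image g) (A.image f) := by
    rw [Finset.disjoint_left]
    intro w hw hw'
    obtain ⟨⟨e, d, s, t⟩, hp, rfl⟩ := Finset.mem_image.mp hw
    obtain ⟨⟨e', a, t'⟩, -, h⟩ := Finset.mem_image.mp hw'
    have hd : d ≠ 0 := (Finset.mem_filter.mp (Finset.mem_sigma.mp hp).2).2.1
    have := congrFun (congrFun h 1) 0
    simp [f, g, borelMatrix, bigCellMatrix] at this
    exact hd this.symm
  rw [add_assoc, ← hA, ← hB, ← Finset.card_image_of_injOn hf, ← Finset.card_image_of_injOn hg,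
    ← Finset.card_union_of_disjoint hdisj, ← Finset.card_map (Function.Embedding.subtype _)]
  congr 1
  ext w
  simp only [Finset.mem_map, Finset.mem_filter, Finset.mem_univ, true_and, Finset.mem_union,
    Finset.mem_image]
  constructor
  · rintro ⟨⟨w, -, hw⟩, rfl, rfl⟩
    by_cases h0 : w 1 0 = 0
    · right
      obtain ⟨ha, he, heq⟩ := eq_borelMatrix_of_orthogonal hw h0
      refine ⟨⟨w 2 2, w 0 0, w 2 1⟩, ?_, heq.symm⟩
      refine Finset.mem_sigma.mpr ⟨(hsign _).mpr he, ?_⟩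
      simp only [Finset.mem_filter, Finset.mem_univ, true_and]
      exact ⟨ha, by rw [← trace_borelMatrix _ _ (w 2 1), ← heq]⟩
    · left
      have he := det_sq_of_orthogonal hw
      have heq := eq_bigCellMatrix_of_orthogonal hw h0
      refine ⟨⟨w.det, w 1 0, w 2 0 / w 1 0, w 2 0 / w 1 0 * w 1 1 - w 2 1⟩, ?_, heq.symm⟩
      refine Finset.mem_sigma.mpr ⟨(hsign _).mpr he, ?_⟩
      simp only [Finset.mem_filter, Finset.mem_univ, true_and]
      exact ⟨h0, by rw [← trace_bigCellMatrix _ _ _ he, ← heq]⟩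
  · rintro (⟨⟨e, d, s, t⟩, hp, rfl⟩ | ⟨⟨e, a, t⟩, hp, rfl⟩)
    · obtain ⟨he, hp⟩ := Finset.mem_sigma.mp hp
      rw [hsign] at he
      obtain ⟨hd, htr⟩ := (Finset.mem_filter.mp hp).2
      have hw := bigCellMatrix_orthogonal s t he hd
      exact ⟨⟨_, hdet _ hw, hw⟩, (trace_bigCellMatrix d s t he).trans htr, rfl⟩
    · obtain ⟨he, hp⟩ := Finset.mem_sigma.mp hp
      rw [hsign] at he
      obtain ⟨ha, htr⟩ := (Finset.mem_filter.mp hp).2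
      have hw := borelMatrix_orthogonal t he ha
      exact ⟨⟨_, hdet _ hw, hw⟩, (trace_borelMatrix e a t).trans htr, rfl⟩

end TraceCount

section TernaryWords

lemma choose_mul_choose_eq_trinom (c a b : ℕ) :
    c.choose a * (c - a).choose b = trinom c a b := by
  unfold trinom
  split_ifs with h
  · symm
    apply Nat.div_eq_of_eq_mul_left (by positivity)
    rw [← Nat.choose_mul_factorial_mul_factorial (show a ≤ c by omega),
      ← Nat.choose_mul_factorial_mul_factorial (show b ≤ c - a by omega)]
    ring
  · by_cases ha : a ≤ c
    · rw [Nat.choose_eq_zero_of_lt (show c - a < b by omega), mul_zero]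
    · rw [Nat.choose_eq_zero_of_lt (by omega), zero_mul]

/-- The ternary word with value 1 on the first component and 2 on the second one. -/
def ternaryWord {α : Type*} [DecidableEq α] (p : Σ _ : Finset α, Finset α) (x : α) : ZMod 3 :=
  if x ∈ p.1 then 1 else if x ∈ p.2 then 2 else 0

lemma ternaryWord_eq_one_iff {α : Type*} [DecidableEq α] {A B : Finset α} (x : α) :
    ternaryWord ⟨A, B⟩ x = 1 ↔ x ∈ A := by
  have h21 : (2 : ZMod 3) ≠ 1 := by decide
  by_cases hA : x ∈ A <;> by_cases hB : x ∈ B <;> simp [ternaryWord, hA, hB, h21]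

lemma ternaryWord_eq_two_iff {α : Type*} [DecidableEq α] {A B : Finset α}
    (hAB : ∀ x ∈ B, x ∉ A) (x : α) : ternaryWord ⟨A, B⟩ x = 2 ↔ x ∈ B := by
  have h12 : (1 : ZMod 3) ≠ 2 := by decide
  have h02 : (0 : ZMod 3) ≠ 2 := by decide
  by_cases hB : x ∈ B
  · simp [ternaryWord, hAB x hB, hB]
  · by_cases hA : x ∈ A <;> simp [ternaryWord, hA, hB, h12, h02]

lemma card_ternary_words (α : Type*) [Fintype α] [DecidableEq α] (a b : ℕ) :
    #{u : α → ZMod 3 | #{x | u x = 1} = a ∧ #{x | u x = 2} = b} =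
      trinom (Fintype.card α) a b := by
  have hsig : #((univ.powersetCard a : Finset (Finset α)).sigma fun A => Aᶜ.powersetCard b) =
      trinom (Fintype.card α) a b := by
    rw [Finset.card_sigma, ← choose_mul_choose_eq_trinom]
    rw [Finset.sum_congr rfl (g := fun _ => (Fintype.card α - a).choose b)]
    · simp
    · intro A hA
      rw [Finset.card_powersetCard, Finset.card_compl, (Finset.mem_powersetCard.mp hA).2]
  rw [← hsig]
  refine Finset.card_nbij'
    (fun u => ⟨({x | u x = 1} : Finset α), ({x | u x = 2} : Finset α)⟩) ternaryWord ?_ ?_ ?_ ?_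
  · intro u hu
    simp at hu
    simp [Finset.mem_powersetCard, hu]
    intro x hx
    simp at hx ⊢
    rw [hx]
    decide
  · rintro ⟨A, B⟩ hp
    simp [Finset.mem_powersetCard] at hp
    obtain ⟨rfl, hAB, rfl⟩ := hp
    have hAB' : ∀ x ∈ B, x ∉ A := fun x hx => by simpa using hAB hx
    simp [ternaryWord_eq_one_iff, ternaryWord_eq_two_iff hAB']
  · intro u hu
    ext x
    simp only [ternaryWord, Finset.mem_filter, Finset.mem_univ, true_and]
    generalize u x = z
    revert z
    decide
  · rintro ⟨A, B⟩ hp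
    simp [Finset.mem_powersetCard] at hp
    obtain ⟨rfl, hAB, rfl⟩ := hp
    have hAB' : ∀ x ∈ B, x ∉ A := fun x hx => by simpa using hAB hx
    simp [ternaryWord_eq_one_iff, ternaryWord_eq_two_iff hAB']

variable {G F : Type*} [Fintype G] [DecidableEq G] [Fintype F] [DecidableEq F]

/-- The numbers of positions above each `β` where a ternary word takes the value 1, and where
it takes the value 2. -/
def fiberType (τ : G → F) (u : G → ZMod 3) : (F → ℕ) × (F → ℕ) :=
  (fun β => #{g | τ g = β ∧ u g = 1}, fun β => #{g | τ g = β ∧ u g = 2})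

lemma card_fiberType_eq (τ : G → F) (p : (F → ℕ) × (F → ℕ)) :
    #{u : G → ZMod 3 | fiberType τ u = p} = ∏ β, trinom #{g | τ g = β} (p.1 β) (p.2 β) := by
  have key : ∀ β, trinom #{g | τ g = β} (p.1 β) (p.2 β) =
      #{u : {g // τ g = β} → ZMod 3 | #{x | u x = 1} = p.1 β ∧ #{x | u x = 2} = p.2 β} := by
    intro β
    rw [card_ternary_words, Fintype.card_subtype]
  have hcard : ∀ (u : G → ZMod 3) (β : F) (z : ZMod 3),
      #{x : {g // τ g = β} | u x = z} = #{g | τ g = β ∧ u g = z} := by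
    intro u β z
    rw [← Finset.card_map (Function.Embedding.subtype _)]
    congr 1
    ext g
    simp
    tauto
  rw [Finset.prod_congr rfl fun β _ => key β, ← Fintype.card_piFinset]
  refine Finset.card_nbij' (fun u β x => u x) (fun v g => v (τ g) ⟨g, rfl⟩) ?_ ?_ ?_ ?_
  · intro u hu
    obtain rfl := (Finset.mem_filter.mp hu).2
    refine Fintype.mem_piFinset.mpr fun β => Finset.mem_filter.mpr ⟨Finset.mem_univ _, ?_⟩
    exact ⟨hcard u β 1, hcard u β 2⟩
  · intro v hv
    simp at hv
    have hv' : ∀ β (x : {g // τ g = β}), v (τ x) ⟨x, rfl⟩ = v β x := by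
      rintro β ⟨g, rfl⟩
      rfl
    refine Finset.mem_filter.mpr ⟨Finset.mem_univ _,
      Prod.ext (funext fun β => ?_) (funext fun β => ?_)⟩
    · simp only [fiberType, ← hcard, hv', hv]
    · simp only [fiberType, ← hcard, hv', hv]
  · intro u hu
    rfl
  · intro v hv
    ext β ⟨g, rfl⟩
    rfl

lemma sum_fiberType (τ : G → F) (u : G → ZMod 3) :
    (∑ β, (fiberType τ u).1 β) + ∑ β, (fiberType τ u).2 β = #{g | u g ≠ 0} := by
  have h : ∀ z : ZMod 3, ∑ β, #{g | τ g = β ∧ u g = z} = #{g | u g = z} := by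
    intro z
    rw [Finset.card_eq_sum_card_fiberwise (f := τ) (t := univ) (by simp)]
    simp [Finset.filter_filter, and_comm]
  have hz : ∀ z : ZMod 3, z ≠ 0 ↔ z = 1 ∨ z = 2 := by decide
  simp only [fiberType, h, hz]
  rw [Finset.filter_or, Finset.card_union_of_disjoint]
  rw [Finset.disjoint_filter]
  intro g _ h1
  rw [h1]
  decide

omit [DecidableEq G] in
lemma sum_mul_eq_sub_fiberType {F : Type*} [Field F] [Fintype F] [DecidableEq F]
    [Algebra (ZMod 3) F] (τ : G → F) (u : G → ZMod 3) :
    ∑ g, algebraMap (ZMod 3) F (u g) * τ g =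
      ∑ β, (fiberType τ u).1 β • β - ∑ β, (fiberType τ u).2 β • β := by
  have h : ∀ z : ZMod 3, ∑ β, #{g | τ g = β ∧ u g = z} • β = ∑ g, if u g = z then τ g else 0 := by
    intro z
    rw [← Finset.sum_filter, ← Finset.sum_fiberwise (g := τ)]
    refine Finset.sum_congr rfl fun β _ => ?_
    rw [Finset.filter_filter, Finset.sum_congr rfl (g := fun _ => β) (by simp), Finset.sum_const]
    simp only [and_comm]
  have hz : ∀ z : ZMod 3, z = 0 ∨ z = 1 ∨ z = 2 := by decide
  have h2 : (2 : ZMod 3) = -1 := by decide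
  simp only [fiberType, h]
  rw [← Finset.sum_sub_distrib]
  refine Finset.sum_congr rfl fun g _ => ?_
  rcases hz (u g) with h' | h' | h'
  · rw [h', if_neg (by decide), if_neg (by decide)]
    simp
  · rw [h', if_pos rfl, if_neg (by decide)]
    simp
  · rw [h', if_neg (by decide), if_pos rfl, h2]
    simp

lemma card_ternary_code_weight {F : Type*} [Field F] [Fintype F] [DecidableEq F]
    [Algebra (ZMod 3) F] (τ : G → F) (j : ℕ)
    [DecidablePred fun p : (F → ℕ) × (F → ℕ) =>
      (∑ β, p.1 β) + (∑ β, p.2 β) = j ∧ (∑ β, p.1 β • β) = ∑ β, p.2 β • β] :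
    #{u : G → ZMod 3 | ∑ g, algebraMap (ZMod 3) F (u g) * τ g = 0 ∧ #{g | u g ≠ 0} = j} =
      ∑ᶠ p : (F → ℕ) × (F → ℕ),
        if (∑ β, p.1 β) + (∑ β, p.2 β) = j ∧ (∑ β, p.1 β • β) = ∑ β, p.2 β • β then
          ∏ β, trinom #{g | τ g = β} (p.1 β) (p.2 β)
        else 0 := by
  rw [finsum_eq_sum_of_support_subset (s := univ.image (fiberType τ)),
    Finset.card_eq_sum_card_fiberwise (f := fiberType τ) (t := univ.image (fiberType τ))]
  · refine Finset.sum_congr rfl fun p _ => ?_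
    rw [← card_fiberType_eq, Finset.filter_filter]
    split_ifs with hp
    · congr 1
      ext u
      simp only [Finset.mem_filter, Finset.mem_univ, true_and, and_iff_right_iff_imp]
      rintro rfl
      rw [sum_mul_eq_sub_fiberType, sub_eq_zero, ← sum_fiberType τ]
      exact hp.symm
    · rw [Finset.card_eq_zero, Finset.filter_eq_empty_iff]
      rintro u - ⟨hu, rfl⟩
      rw [sum_mul_eq_sub_fiberType, sub_eq_zero, ← sum_fiberType τ] at hu
      exact hp hu.symm
  · intro u _
    simp
  · intro p hp
    rw [Function.mem_support, ← card_fiberType_eq] at hp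
    obtain ⟨u, hu⟩ := Finset.card_ne_zero.mp (ite_ne_right_iff.mp hp).2
    simp only [Finset.mem_filter, Finset.mem_univ, true_and] at hu
    simp only [Finset.coe_image, Finset.coe_univ, Set.image_univ, Set.mem_range]
    exact ⟨u, hu⟩

end TernaryWords

open Classical in
/-- The weight distribution of C(O(3,q)): the number of codewords of weight j equals
the sum over all pairs ν, μ : F_q → ℕ with ∑ν(β) + ∑μ(β) = j and ∑ν(β)·β = ∑μ(β)·β of
∏_β T(n₂(β); ν(β), μ(β)), where n₂(β) = 2q² - 2q + q·δ(1,q;β-1) + q·δ(1,q;β+1) and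
q = 3^r. -/
theorem weight_distribution_O3 (r : ℕ) (hr : 0 < r) (F : Type) [Field F] [Fintype F]
    [DecidableEq F] [Algebra (ZMod 3) F] (hF : Fintype.card F = 3 ^ r)
    (j : ℕ) (hj : j ≤ 2 * 3 ^ r * ((3 ^ r) ^ 2 - 1)) :
    weightCountO F j =
      ∑ᶠ p : (F → ℕ) × (F → ℕ),
        if (∑ β : F, p.1 β) + (∑ β : F, p.2 β) = j ∧
            (∑ β : F, p.1 β • β) = (∑ β : F, p.2 β • β) then
          ∏ β : F, trinom
            (2 * 3 ^ r * 3 ^ r - 2 * 3 ^ r + 3 ^ r * delta1 F (β - 1)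
              + 3 ^ r * delta1 F (β + 1))
            (p.1 β) (p.2 β)
        else 0 := by
  have : CharP F 3 := charP_of_injective_algebraMap (algebraMap (ZMod 3) F).injective 3
  unfold weightCountO
  simp only [← hF, ← card_orthogonal_trace_eq]
  convert card_ternary_code_weight (F := F)
    (fun g : {w : Matrix (Fin 3) (Fin 3) F // w.det ≠ 0 ∧ wᵀ * matJ F * w = matJ F} =>
      g.val.trace) j
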